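/- arXiv:1905.08391 — 3 statements merged into one kernel-verified Lean document; each statement's English description precedes it below -/
import Mathlib

section
/- Let F be a field, X a finite partial order, G an additive abelian group, and A = IncidenceAlgebra F X equipped with a G-grading ℬ (GradedAlgebra ℬ). Let e ∈ ℬ 0 be a nonzero idempotent (e*e = e) that is minimal in the following sense: every nonzero idempotent e' ∈ ℬ 0 with e*e' = e' (equivalently, e'·A ⊆ e·A) also satisfies e'*e = e (equivalently, e·A ⊆ e'·A). Then the corner algebra eAe = {e*a*e | a ∈ A} satisfies: (1) it is commutative: (e*a*e)*(e*b*e) = (e*b*e)*(e*a*e) for all a, b ∈ A; (2) it is a graded division algebra with unit e: for every g ∈ G and every x ∈ ℬ g with e*x*e = x and x ≠ 0 there exists y ∈ A with e*y*e = y, x*y = e, and y*x = e; (3) each of its homogeneous components has dimension at most one: for every g ∈ G, the F-dimension of {x ∈ ℬ g | e*x*e = x} is at most 1. -/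
/-- The linear map `x ↦ e * x * f` on an algebra. -/
noncomputable def cornerMap (F : Type*) {A : Type*} [Field F] [Ring A] [Algebra F A]
    (e f : A) : A →ₗ[F] A :=
  (LinearMap.mulRight F f).comp (LinearMap.mulLeft F e)

namespace IncidenceAlgebra

/-- Evaluation at the diagonal entry `x`, as an algebra homomorphism. -/
def diagHom (F : Type*) {X : Type*} [Field F] [PartialOrder X] [DecidableEq X]
    [LocallyFiniteOrder X] (x : X) : IncidenceAlgebra F X →ₐ[F] F where
  toFun f := f x x
  map_one' := by simp
  map_mul' f g := by simp
  map_zero' := rfl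
  map_add' _ _ := rfl
  commutes' r := by simp [Algebra.algebraMap_eq_smul_one, constSMul_apply]

theorem diagHom_apply {F X : Type*} [Field F] [PartialOrder X] [DecidableEq X]
    [LocallyFiniteOrder X] (x : X) (f : IncidenceAlgebra F X) : diagHom F x f = f x x := rfl

/-- The matrix unit concentrated at the diagonal entry `x`. -/
def diagUnit (F : Type*) {X : Type*} [Field F] [PartialOrder X] [DecidableEq X] (x : X) :
    IncidenceAlgebra F X where
  toFun a b := if a = x ∧ b = x then 1 else 0
  eq_zero_of_not_le' _ _ h := if_neg fun hab ↦ h (hab.1.trans hab.2.symm).le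

theorem diagUnit_apply {F X : Type*} [Field F] [PartialOrder X] [DecidableEq X] (x a b : X) :
    diagUnit F x a b = if a = x ∧ b = x then 1 else 0 := rfl

theorem diagUnit_mul_eq_zero {F X : Type*} [Field F] [PartialOrder X] [DecidableEq X]
    [LocallyFiniteOrder X] {x : X} {j : IncidenceAlgebra F X} (h : ∀ y, j x y = 0) :
    diagUnit F x * j = 0 := by
  ext a b _
  rw [mul_apply, zero_apply]
  refine Finset.sum_eq_zero fun z _ ↦ ?_
  rw [diagUnit_apply]
  split_ifs with hz
  · rw [hz.2, h, mul_zero]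
  · rw [zero_mul]

instance moduleFinite (F X : Type*) [Field F] [PartialOrder X] [Finite X] :
    Module.Finite F (IncidenceAlgebra F X) :=
  Module.Finite.of_injective
    ({ toFun := fun f ↦ f
       map_add' := fun _ _ ↦ rfl
       map_smul' := fun _ _ ↦ rfl } : IncidenceAlgebra F X →ₗ[F] X → X → F)
    DFunLike.coe_injective

/-- A row that is fixed by right multiplication by `e` and vanishes on the diagonal is zero if `e`
has no nonzero diagonal entries further along. -/
theorem row_eq_zero {F X : Type*} [Field F] [PartialOrder X] [Finite X]
    [LocallyFiniteOrder X] {e j : IncidenceAlgebra F X} (hj : j * e = j) {x : X}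
    (hx : j x x = 0) (he : ∀ y, x < y → e y y = 0) (y : X) : j x y = 0 := by
  induction y using WellFoundedLT.induction with
  | _ y ih =>
    by_cases hxy : x < y
    · rw [← hj, mul_apply]
      refine Finset.sum_eq_zero fun z hz ↦ ?_
      rcases (Finset.mem_Icc.1 hz).2.lt_or_eq with h | rfl
      · rw [ih z h, zero_mul]
      · rw [he z hxy, mul_zero]
    · by_cases h : x = y
      · rw [← h, hx]
      · exact apply_eq_zero_of_not_le (fun hle ↦ hxy (lt_of_le_of_ne hle h)) j

theorem exists_diag_ne_zero_of_idempotent {F X : Type*} [Field F] [PartialOrder X] [Finite X]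
    [LocallyFiniteOrder X] {e : IncidenceAlgebra F X} (he : e * e = e) (hne : e ≠ 0) :
    ∃ x, e x x ≠ 0 := by
  by_contra! h
  exact hne (ext fun x y _ ↦ row_eq_zero he (h x) (fun z _ ↦ h z) y)

end IncidenceAlgebra

/-- Integral elements over a field are strongly π-regular. -/
theorem IsIntegral.exists_pow_eq_pow_mul {F A : Type*} [Field F] [Ring A] [Algebra F A] {d : A}
    (hd : IsIntegral F d) :
    ∃ n, 0 < n ∧ ∃ b ∈ Algebra.adjoin F {d}, d ^ n = d ^ (n + n) * b := by
  open Polynomial in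
  obtain ⟨q, hq, hdvd⟩ :=
    exists_eq_pow_rootMultiplicity_mul_and_not_dvd (minpoly F d) (minpoly.ne_zero hd) 0
  set n := rootMultiplicity 0 (minpoly F d)
  rw [C_0, sub_zero] at hq hdvd
  have hcop : IsCoprime ((X : F[X]) ^ (n + 1)) q :=
    ((irreducible_X.coprime_iff_not_dvd).2 hdvd).pow_left
  obtain ⟨a, b, hab⟩ := hcop
  refine ⟨n + 1, n.succ_pos, aeval d a, aeval_mem_adjoin_singleton F d, ?_⟩
  have h : (X : F[X]) ^ (n + 1) = X ^ (n + 1 + (n + 1)) * a + minpoly F d * (X * b) := by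
    rw [hq]
    linear_combination (-(X : F[X]) ^ (n + 1)) * hab
  simpa using congrArg (aeval d) h

section GradedAlgebra

variable {F A G : Type*} [Field F] [Ring A] [Algebra F A] [AddCommGroup G] [DecidableEq G]
  (ℬ : G → Submodule F A) [GradedAlgebra ℬ]

theorem GradedAlgebra.isOfFinAddOrder_of_not_isNilpotent [Module.Finite F A] {g : G} {c : A}
    (hc : c ∈ ℬ g) (hnil : ¬ IsNilpotent c) : IsOfFinAddOrder g := by
  by_contra h
  have hinj := injective_nsmul_iff_not_isOfFinAddOrder.2 h
  have hfin : {i | ℬ i ≠ ⊥}.Finite :=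
    WellFoundedGT.finite_ne_bot_of_iSupIndep
      (DirectSum.Decomposition.isInternal ℬ).submodule_iSupIndep
  refine Set.infinite_range_of_injective hinj (hfin.subset ?_)
  rintro _ ⟨n, rfl⟩ hbot
  have hmem : c ^ n ∈ ℬ (n • g) := SetLike.pow_mem_graded n hc
  exact hnil ⟨n, by simpa [show ℬ (n • g) = ⊥ from hbot] using hmem⟩

theorem GradedAlgebra.corner_mem {e : A} (he : e ∈ ℬ 0) {g : G} {a : A} (ha : a ∈ ℬ g) :
    e * a * e ∈ ℬ g := by
  simpa using SetLike.mul_mem_graded (SetLike.mul_mem_graded he ha) he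

/-- In the corner of a minimal homogeneous idempotent, every homogeneous element that is not
nilpotent is invertible. -/
theorem GradedAlgebra.exists_corner_inverse [Module.Finite F A] {e : A} (he_idem : e * e = e)
    (he_min : ∀ e' : A, e' ∈ ℬ 0 → e' * e' = e' → e' ≠ 0 → e * e' = e' → e' * e = e)
    {g : G} {c : A} (hc : c ∈ ℬ g) (hec : e * c * e = c) (hnil : ¬ IsNilpotent c) :
    ∃ y, e * y * e = y ∧ c * y = e ∧ y * c = e := by
  obtain ⟨m, hm, hmg⟩ := isOfFinAddOrder_iff_nsmul_eq_zero.1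
    (GradedAlgebra.isOfFinAddOrder_of_not_isNilpotent ℬ hc hnil)
  have hd : c ^ m ∈ ℬ 0 := hmg ▸ SetLike.pow_mem_graded m hc
  obtain ⟨n, hn, b, hb, hdb⟩ :=
    (Algebra.IsIntegral.isIntegral (R := F) (c ^ m)).exists_pow_eq_pow_mul
  have hb0 : b ∈ ℬ 0 :=
    Algebra.adjoin_le (S := SetLike.GradeZero.subalgebra ℬ) (Set.singleton_subset_iff.2 hd) hb
  have hcb : Commute c b := by
    have := Algebra.adjoin_le (S := Subalgebra.centralizer F {c}) (s := {c ^ m})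
      (by simp [Set.mem_centralizer_iff, (Commute.self_pow c m).eq]) hb
    exact Subalgebra.mem_centralizer_iff F |>.1 this c rfl
  have hecl : e * c = c := by rw [← hec]; simp only [← mul_assoc, he_idem]
  have hecr : c * e = c := by rw [← hec]; simp only [mul_assoc, he_idem]
  obtain ⟨k, hk⟩ : ∃ k, m * n = k + 1 := Nat.exists_eq_add_one.2 (Nat.mul_pos hm hn)
  have hdb' : c ^ (k + 1) = c ^ (k + 1) * c ^ (k + 1) * b := by
    rwa [pow_add, ← pow_mul, hk] at hdb
  have hel : e * c ^ (k + 1) = c ^ (k + 1) := by rw [pow_succ', ← mul_assoc, hecl]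
  have her : c ^ (k + 1) * e = c ^ (k + 1) := by rw [pow_succ, mul_assoc, hecr]
  have hpb : Commute (c ^ (k + 1)) b := hcb.pow_left _
  have hf : c ^ (k + 1) * b = e := by
    rw [← he_min (c ^ (k + 1) * b) ?_ ?_ ?_ ?_]
    · rw [hpb.eq, mul_assoc, her]
    · rw [← hk, pow_mul]
      simpa using SetLike.mul_mem_graded (SetLike.pow_mem_graded n hd) hb0
    · calc c ^ (k + 1) * b * (c ^ (k + 1) * b)
          = c ^ (k + 1) * (b * c ^ (k + 1)) * b := by simp only [mul_assoc]
        _ = c ^ (k + 1) * c ^ (k + 1) * b * b := by rw [← hpb.eq]; simp only [mul_assoc]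
        _ = c ^ (k + 1) * b := by rw [← hdb']
    · intro h0
      exact hnil ⟨k + 1, by rw [hdb', mul_assoc, h0, mul_zero]⟩
    · rw [← mul_assoc, hel]
  have h1 : c * (c ^ k * b) = e := by rw [← mul_assoc, ← pow_succ', hf]
  have h2 : c ^ k * b * c = e := by rw [mul_assoc, ← hcb.eq, ← mul_assoc, ← pow_succ, hf]
  refine ⟨e * (c ^ k * b) * e, ?_, ?_, ?_⟩
  · simp only [← mul_assoc, he_idem]
    simp only [mul_assoc, he_idem]
  · rw [← mul_assoc, ← mul_assoc, hecr, h1, he_idem]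
  · rw [mul_assoc, hecl, mul_assoc, h2, he_idem]

end GradedAlgebra

namespace IncidenceAlgebra

variable {F X G : Type*} [Field F] [PartialOrder X] [DecidableEq X]
  [LocallyFiniteOrder X] [AddCommGroup G] [DecidableEq G]
  (ℬ : G → Submodule F (IncidenceAlgebra F X)) [GradedAlgebra ℬ]

theorem not_isNilpotent_of_diag_ne_zero {c : IncidenceAlgebra F X} {x : X} (h : c x x ≠ 0) :
    ¬ IsNilpotent c :=
  fun hc ↦ h (hc.map (diagHom F x)).eq_zero

/-- The corner of a minimal homogeneous idempotent contains no nonzero homogeneous element with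
zero diagonal. -/
theorem eq_zero_of_diag_eq_zero [Finite X] {e : IncidenceAlgebra F X} (he_mem : e ∈ ℬ 0)
    (he_idem : e * e = e) (he_ne : e ≠ 0)
    (he_min : ∀ e' : IncidenceAlgebra F X, e' ∈ ℬ 0 → e' * e' = e' → e' ≠ 0 →
      e * e' = e' → e' * e = e)
    {g : G} {j : IncidenceAlgebra F X} (hj : j ∈ ℬ g) (hej : e * j * e = j)
    (hdiag : ∀ x, j x x = 0) : j = 0 := by
  have hejl : e * j = j := by rw [← hej]; simp only [← mul_assoc, he_idem]
  have hejr : j * e = j := by rw [← hej]; simp only [mul_assoc, he_idem]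
  obtain ⟨x, hx⟩ := (Set.toFinite {x | e x x ≠ 0}).exists_maximal
    (exists_diag_ne_zero_of_idempotent he_idem he_ne)
  have hrow : diagUnit F x * j = 0 := diagUnit_mul_eq_zero <|
    row_eq_zero hejr (hdiag x) fun y hxy ↦ by
      by_contra hy
      exact hx.not_gt hy hxy
  obtain ⟨i, hi⟩ : ∃ i,
      (DirectSum.decompose ℬ (diagUnit F x) i : IncidenceAlgebra F X) x x ≠ 0 := by
    classical
    by_contra! h
    have hsum := congrArg (diagHom F x) (DirectSum.sum_support_decompose ℬ (diagUnit F x))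
    rw [map_sum, Finset.sum_eq_zero (fun i _ ↦ (diagHom_apply x _).trans (h i)), diagHom_apply,
      diagUnit_apply] at hsum
    simp at hsum
  set c := (DirectSum.decompose ℬ (diagUnit F x) i : IncidenceAlgebra F X)
  have hcj : c * j = 0 := by
    rw [← DirectSum.coe_decompose_mul_add_of_right_mem ℬ hj, hrow]
    simp
  have hdc : (e * c * e) x x ≠ 0 := by
    have hxe : e x x ≠ 0 := hx.prop
    simpa using And.intro (And.intro hxe hi) hxe
  obtain ⟨y, -, -, hy⟩ := GradedAlgebra.exists_corner_inverse ℬ he_idem he_min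
    (GradedAlgebra.corner_mem ℬ he_mem (SetLike.coe_mem _ : c ∈ ℬ i))
    (by simp only [← mul_assoc, he_idem]; simp only [mul_assoc, he_idem])
    (not_isNilpotent_of_diag_ne_zero hdc)
  rw [← hejl, ← hy, mul_assoc, mul_assoc, hejl, mul_assoc, hcj, mul_zero, mul_zero]

end IncidenceAlgebra

/-- The corner of a graded incidence algebra at a minimal homogeneous idempotent is a
commutative graded division algebra whose homogeneous components are at most
one-dimensional. -/
theorem corner_of_minimal_idempotent
    {F X G : Type*} [Field F] [PartialOrder X] [Fintype X] [DecidableEq X]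
    [LocallyFiniteOrder X] [AddCommGroup G] [DecidableEq G]
    (ℬ : G → Submodule F (IncidenceAlgebra F X)) [GradedAlgebra ℬ]
    (e : IncidenceAlgebra F X) (he_mem : e ∈ ℬ 0) (he_idem : e * e = e) (he_ne : e ≠ 0)
    (he_min : ∀ e' : IncidenceAlgebra F X, e' ∈ ℬ 0 → e' * e' = e' → e' ≠ 0 →
      e * e' = e' → e' * e = e) :
    (∀ a b : IncidenceAlgebra F X,
        (e * a * e) * (e * b * e) = (e * b * e) * (e * a * e)) ∧
    (∀ (g : G) (x : IncidenceAlgebra F X), x ∈ ℬ g → e * x * e = x → x ≠ 0 →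
        ∃ y : IncidenceAlgebra F X, e * y * e = y ∧ x * y = e ∧ y * x = e) ∧
    (∀ g : G, Module.finrank F
        ↥(ℬ g ⊓ LinearMap.eqLocus (cornerMap F e e) (LinearMap.id (R := F))) ≤ 1) := by
  have hzero {g : G} {j : IncidenceAlgebra F X} (hj : j ∈ ℬ g) (hej : e * j * e = j)
      (hdiag : ∀ x, j x x = 0) : j = 0 :=
    IncidenceAlgebra.eq_zero_of_diag_eq_zero ℬ he_mem he_idem he_ne he_min hj hej hdiag
  have hdiv (g : G) (x : IncidenceAlgebra F X) (hx : x ∈ ℬ g) (hex : e * x * e = x)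
      (hne : x ≠ 0) : ∃ y : IncidenceAlgebra F X, e * y * e = y ∧ x * y = e ∧ y * x = e := by
    obtain ⟨p, hp⟩ : ∃ p, x p p ≠ 0 := by
      by_contra! h
      exact hne (hzero hx hex h)
    exact GradedAlgebra.exists_corner_inverse ℬ he_idem he_min hx hex
      (IncidenceAlgebra.not_isNilpotent_of_diag_ne_zero hp)
  refine ⟨fun a b ↦ ?_, hdiv, fun g ↦ ?_⟩
  · induction a using DirectSum.Decomposition.inductionOn ℬ with
    | zero => simp
    | add a a' ha ha' => simp only [mul_add, add_mul, ha, ha']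
    | @homogeneous g a =>
      induction b using DirectSum.Decomposition.inductionOn ℬ with
      | zero => simp
      | add b b' hb hb' => simp only [mul_add, add_mul, hb, hb']
      | @homogeneous h b =>
        have ha := GradedAlgebra.corner_mem ℬ he_mem a.2
        have hb := GradedAlgebra.corner_mem ℬ he_mem b.2
        refine sub_eq_zero.1 (hzero (g := g + h) (Submodule.sub_mem _
          (SetLike.mul_mem_graded ha hb) (add_comm h g ▸ SetLike.mul_mem_graded hb ha)) ?_ ?_)
        · simp only [mul_sub, sub_mul, ← mul_assoc, he_idem]
          simp only [mul_assoc, he_idem]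
        · intro x
          rw [← IncidenceAlgebra.diagHom_apply, map_sub, map_mul _ (e * a * e), map_mul _ (e * b * e),
            mul_comm, sub_self]
  · obtain ⟨p, hp⟩ := IncidenceAlgebra.exists_diag_ne_zero_of_idempotent he_idem he_ne
    set S := ℬ g ⊓ LinearMap.eqLocus (cornerMap F e e) (LinearMap.id (R := F))
    have hS (w : S) (hw : w.1 p p = 0) : w = 0 := by
      by_contra hne
      obtain ⟨y, -, hy, -⟩ := hdiv g w.1 w.2.1 w.2.2 (by simpa using hne)
      apply hp
      rw [← hy, ← IncidenceAlgebra.diagHom_apply, map_mul, IncidenceAlgebra.diagHom_apply, hw,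
        zero_mul]
    by_cases h : ∃ v : S, v.1 p p ≠ 0
    · obtain ⟨v, hv⟩ := h
      refine finrank_le_one v fun w ↦ ⟨w.1 p p / v.1 p p, sub_eq_zero.1 (hS _ ?_)⟩
      change w.1 p p / v.1 p p * v.1 p p - w.1 p p = 0
      rw [div_mul_cancel₀ _ hv, sub_self]
    · push Not at h
      exact finrank_le_one 0 fun w ↦ ⟨0, by rw [hS w (h w), smul_zero]⟩
end

section
/- Let F be a field, X a finite partial order, G an additive abelian group, and A = IncidenceAlgebra F X equipped with a G-grading ℬ (GradedAlgebra ℬ). Then there exist t ∈ ℕ and elements e 1, ..., e t ∈ ℬ 0 such that: each e i is idempotent; e i * e j = 0 for i ≠ j; e 1 + ⋯ + e t = 1; and for every i the corner algebra (e i)·A·(e i) = {(e i)*a*(e i) | a ∈ A} is commutative, every nonzero element x ∈ ℬ g with (e i)*x*(e i) = x has an inverse y in the corner (i.e., (e i)*y*(e i) = y, x*y = e i, y*x = e i), and the F-dimension of {x ∈ ℬ g | (e i)*x*(e i) = x} is at most 1 for every g ∈ G. Moreover, for all i, j, the F-dimension of {(e i)*a*(e j) | a ∈ A} is at most the product of the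 F-dimensions of (e i)·A·(e i) and (e j)·A·(e j). -/
/-- `e` is a nonzero idempotent of `S` that dominates no other nonzero idempotent of `S`. -/
structure IsPrimitiveIdempotentIn {A : Type*} [Ring A] (S : Set A) (e : A) : Prop where
  mem : e ∈ S
  idem : e * e = e
  ne_zero : e ≠ 0
  eq_of_dominated : ∀ p ∈ S, p * p = p → e * p = p → p * e = p → p ≠ 0 → p = e

section FiniteDimensionalAlgebra

open Polynomial

/-- Fitting's lemma: if an algebraic element is not killed by a character, some multiple of it
by a polynomial in it is an idempotent on which the character is one. -/
lemma exists_aeval_mul_self_idempotent {F A : Type*} [Field F] [Ring A] [Algebra F A]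
    (χ : A →ₐ[F] F) {w : A} (hw : IsIntegral F w) (hχ : χ w ≠ 0) :
    ∃ r : F[X], (w * aeval w r) * (w * aeval w r) = w * aeval w r ∧
      χ (w * aeval w r) = 1 := by
  have h0 : minpoly F w ≠ 0 := minpoly.ne_zero hw
  obtain ⟨q, hq, hXq⟩ := exists_eq_pow_rootMultiplicity_mul_and_not_dvd (minpoly F w) h0 0
  rw [C_0, sub_zero] at hq hXq
  set k := rootMultiplicity 0 (minpoly F w)
  have hcop : IsCoprime (X ^ (k + 1)) q :=
    ((irreducible_X.coprime_iff_not_dvd).2 hXq).pow_left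
  obtain ⟨a, b, hab⟩ := hcop
  have hμ : aeval w (X ^ k * q) = 0 := by rw [← hq]; exact minpoly.aeval F w
  have hpoly : w * aeval w (a * X ^ k) = aeval w (a * X ^ (k + 1)) := by
    rw [show a * X ^ (k + 1) = X * (a * X ^ k) by ring, map_mul _ X, aeval_X]
  have hone : aeval w (a * X ^ (k + 1)) = 1 - aeval w (b * q) := by
    rw [← map_one (aeval (R := F) w), ← map_sub, ← hab]
    congr 1
    ring
  refine ⟨a * X ^ k, ?_, ?_⟩
  · have hz : aeval w (a * X ^ (k + 1)) * aeval w (b * q) = 0 := by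
      rw [← map_mul, show a * X ^ (k + 1) * (b * q) = a * X * b * (X ^ k * q) by ring, map_mul, hμ,
        mul_zero]
    rw [hpoly]
    nth_rewrite 2 [hone]
    rw [mul_sub, hz, mul_one, sub_zero]
  · have hqχ : χ (aeval w q) = 0 := by
      have := congrArg χ hμ
      rw [map_mul, map_mul, map_pow, aeval_X, map_pow, map_zero] at this
      exact (mul_eq_zero.1 this).resolve_left (pow_ne_zero _ hχ)
    rw [hpoly, hone, map_sub, map_one, map_mul, map_mul, hqχ, mul_zero, sub_zero]

end FiniteDimensionalAlgebra

section GradedAlgebra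

variable {F A G : Type*} [Field F] [Ring A] [Algebra F A] [AddCommGroup G] [DecidableEq G]

lemma aeval_mem_gradedAlgebra_zero (ℬ : G → Submodule F A) [GradedAlgebra ℬ] {w : A}
    (hw : w ∈ ℬ 0) (r : Polynomial F) : Polynomial.aeval w r ∈ ℬ 0 := by
  rw [Polynomial.aeval_eq_sum_range]
  refine Submodule.sum_mem _ fun i _ => Submodule.smul_mem _ _ ?_
  simpa using SetLike.pow_mem_graded i hw

/-- In a finite-dimensional graded algebra, a degree with a non-nilpotent element is torsion. -/
lemma exists_pos_nsmul_eq_zero_of_pow_ne_zero [Module.Finite F A] (ℬ : G → Submodule F A)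
    [GradedAlgebra ℬ] {g : G} {x : A} (hx : x ∈ ℬ g) (hpow : ∀ n : ℕ, x ^ n ≠ 0) :
    ∃ n : ℕ, 0 < n ∧ n • g = 0 := by
  have hfin : {h | ℬ h ≠ ⊥}.Finite := WellFoundedGT.finite_ne_bot_of_iSupIndep
    (DirectSum.Decomposition.isInternal ℬ).submodule_iSupIndep
  have hmaps : ∀ n : ℕ, n • g ∈ {h | ℬ h ≠ ⊥} := fun n hbot =>
    hpow n ((Submodule.eq_bot_iff _).1 hbot _ (SetLike.pow_mem_graded n hx))
  obtain ⟨k, -, l, -, hne, hkl⟩ :=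
    Set.infinite_univ.exists_ne_map_eq_of_mapsTo (fun n _ => hmaps n) hfin
  rcases lt_or_gt_of_ne hne with h | h
  · exact ⟨l - k, by omega, by rw [sub_nsmul _ h.le, hkl]; simp⟩
  · exact ⟨k - l, by omega, by rw [sub_nsmul _ h.le, hkl]; simp⟩

/-- In the corner of a primitive degree-zero idempotent, homogeneous elements not killed by some
character are invertible. -/
lemma exists_corner_inverse [Module.Finite F A] (ℬ : G → Submodule F A) [GradedAlgebra ℬ]
    (χ : A →ₐ[F] F) {e x : A} {g : G} (he : IsPrimitiveIdempotentIn (ℬ 0 : Set A) e)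
    (hx : x ∈ ℬ g) (hex : e * x = x) (hxe : x * e = x) (hχ : χ x ≠ 0) :
    ∃ y : A, e * y * e = y ∧ x * y = e ∧ y * x = e := by
  have hpow : ∀ n : ℕ, x ^ n ≠ 0 := fun n h => by
    have := congrArg χ h
    rw [map_pow, map_zero] at this
    exact pow_ne_zero n hχ this
  obtain ⟨n, hn, hng⟩ := exists_pos_nsmul_eq_zero_of_pow_ne_zero ℬ hx hpow
  obtain ⟨m, rfl⟩ : ∃ m, n = m + 1 := ⟨n - 1, by omega⟩
  have hw : x ^ (m + 1) ∈ ℬ 0 := hng ▸ SetLike.pow_mem_graded (m + 1) hx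
  obtain ⟨r, hidem, hone⟩ := exists_aeval_mul_self_idempotent χ
    (Algebra.IsIntegral.isIntegral (R := F) (x ^ (m + 1))) (by rw [map_pow]; exact pow_ne_zero _ hχ)
  set s := Polynomial.aeval (x ^ (m + 1)) r
  have hcomm : Commute x s := by
    have : s ∈ Algebra.adjoin F {x} := by
      have h1 : x ^ (m + 1) ∈ Algebra.adjoin F {x} :=
        pow_mem (Algebra.self_mem_adjoin_singleton F x) _
      exact Algebra.adjoin_le (Set.singleton_subset_iff.2 h1)
        (Polynomial.aeval_mem_adjoin_singleton F _)
    exact Algebra.commute_of_mem_adjoin_self this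
  have hmem : x ^ (m + 1) * s ∈ ℬ 0 := by
    simpa using SetLike.mul_mem_graded hw (aeval_mem_gradedAlgebra_zero ℬ hw r)
  have hp : x ^ (m + 1) * s = e := by
    refine he.eq_of_dominated _ hmem hidem ?_ ?_ ?_
    · rw [pow_succ', ← mul_assoc, ← mul_assoc, hex]
    · rw [(hcomm.pow_left _).eq, mul_assoc, pow_succ, mul_assoc, hxe]
    · intro h
      rw [h, map_zero] at hone
      exact zero_ne_one hone
  refine ⟨e * (x ^ m * s) * e, ?_, ?_, ?_⟩
  · simp only [mul_assoc, he.idem]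
    simp only [← mul_assoc, he.idem]
  · rw [← mul_assoc, ← mul_assoc, hxe, ← mul_assoc, ← pow_succ', hp, he.idem]
  · rw [mul_assoc, hex, mul_assoc, mul_assoc, ← hcomm.eq, ← mul_assoc (x ^ m), ← pow_succ, hp,
      he.idem]

end GradedAlgebra

/-- Orthogonal decomposition of an idempotent into primitive ones, provided idempotents carry a
natural number that strictly drops when passing to a proper direct summand. -/
lemma exists_orthogonal_primitive_decomposition {A S : Type*} [Ring A] [SetLike S A]
    [AddSubgroupClass S A] (B : S) (rk : A → ℕ)
    (hrk : ∀ e p : A, e * e = e → p * p = p → e * p = p → p * e = p → p ≠ e → rk p < rk e)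
    (e : A) (he : e ∈ B) (hidem : e * e = e) :
    ∃ (ι : Type) (_ : Fintype ι) (f : ι → A),
      (∀ i, IsPrimitiveIdempotentIn (B : Set A) (f i)) ∧
      (∀ i j, i ≠ j → f i * f j = 0) ∧ ∑ i, f i = e := by
  induction hn : rk e using Nat.strong_induction_on generalizing e with
  | _ n ih =>
  by_cases h0 : e = 0
  · exact ⟨PEmpty, inferInstance, PEmpty.elim, fun i => i.elim, fun i => i.elim, by simp [h0]⟩
  by_cases hprim : IsPrimitiveIdempotentIn (B : Set A) e
  · refine ⟨Unit, inferInstance, fun _ => e, fun _ => hprim, fun i j h => (h rfl).elim, by simp⟩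
  obtain ⟨p, hpB, hpp, hep, hpe, hp0, hne⟩ : ∃ p ∈ B, p * p = p ∧ e * p = p ∧ p * e = p ∧
      p ≠ 0 ∧ p ≠ e := by
    by_contra! h
    exact hprim ⟨he, hidem, h0, fun p h1 h2 h3 h4 h5 => h p h1 h2 h3 h4 h5⟩
  have hqq : (e - p) * (e - p) = e - p := by
    simp only [mul_sub, sub_mul, hidem, hep, hpe, hpp]; abel
  obtain ⟨ι, _, f, hf, hfo, hfs⟩ := ih _ (hn ▸ hrk e p hidem hpp hep hpe hne) p hpB hpp rfl
  obtain ⟨κ, _, f', hf', hfo', hfs'⟩ := ih _ (hn ▸ hrk e (e - p) hidem hqq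
    (by rw [mul_sub, hidem, hep]) (by rw [sub_mul, hidem, hpe])
    (by simpa using hp0)) (e - p) (sub_mem he hpB) hqq rfl
  have absorb : ∀ {ι : Type} [Fintype ι] (f : ι → A) (s : A), (∀ i, f i * f i = f i) →
      (∀ i j, i ≠ j → f i * f j = 0) → ∑ i, f i = s → ∀ i, f i * s = f i ∧ s * f i = f i := by
    intro ι _ f s h1 h2 h3 i
    rw [← h3, Finset.mul_sum, Finset.sum_mul]
    exact ⟨by rw [Finset.sum_eq_single i (fun j _ hj => h2 i j hj.symm) (by simp), h1],
      by rw [Finset.sum_eq_single i (fun j _ hj => h2 j i hj) (by simp), h1]⟩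
  have a1 := absorb f p (fun i => (hf i).idem) hfo hfs
  have a2 := absorb f' (e - p) (fun i => (hf' i).idem) hfo' hfs'
  refine ⟨ι ⊕ κ, inferInstance, Sum.elim f f', ?_, ?_, ?_⟩
  · rintro (i | i)
    · exact hf i
    · exact hf' i
  · rintro (i | i) (j | j) hij
    · exact hfo i j fun h => hij (h ▸ rfl)
    · change f i * f' j = 0
      rw [← (a1 i).1, ← (a2 j).2, mul_assoc, ← mul_assoc p, mul_sub, hpe, hpp, sub_self, zero_mul,
        mul_zero]
    · change f' i * f j = 0
      rw [← (a2 i).1, ← (a1 j).2, mul_assoc, ← mul_assoc (e - p), sub_mul, hep, hpp, sub_self,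
        zero_mul, mul_zero]
    · exact hfo' i j fun h => hij (h ▸ rfl)
  · simp [Fintype.sum_sum_type, hfs, hfs']

lemma mul_cornerMap {F A : Type*} [Field F] [Ring A] [Algebra F A] {e : A} (he : e * e = e)
    (f v : A) :
    e * cornerMap F e f v = cornerMap F e f v := by
  simp only [cornerMap, LinearMap.comp_apply, LinearMap.mulLeft_apply, LinearMap.mulRight_apply,
    ← mul_assoc, he]

lemma cornerMap_mul {F A : Type*} [Field F] [Ring A] [Algebra F A] {f : A} (hf : f * f = f)
    (e v : A) :
    cornerMap F e f v * f = cornerMap F e f v := by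
  simp only [cornerMap, LinearMap.comp_apply, LinearMap.mulLeft_apply, LinearMap.mulRight_apply,
    mul_assoc, hf]

namespace IncidenceAlgebra

variable {F X : Type*} [Field F] [PartialOrder X]

/-- The diagonal incidence function with prescribed diagonal entries. -/
def diag [DecidableEq X] (c : X → F) : IncidenceAlgebra F X where
  toFun x y := if x = y then c x else 0
  eq_zero_of_not_le' _ _ h := if_neg fun hxy => h hxy.le

@[simp] lemma diag_apply_self [DecidableEq X] (c : X → F) (x : X) : diag c x x = c x := if_pos rfl

open Classical in
/-- The points at which the diagonal of an incidence function does not vanish. -/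
noncomputable def diagSupport [Fintype X] (e : IncidenceAlgebra F X) : Finset X :=
  Finset.univ.filter fun x => e x x ≠ 0

@[simp] lemma mem_diagSupport [Fintype X] {e : IncidenceAlgebra F X} {x : X} :
    x ∈ diagSupport e ↔ e x x ≠ 0 := by
  simp [diagSupport]

variable [LocallyFiniteOrder X]

lemma mul_apply_self (f g : IncidenceAlgebra F X) (x : X) : (f * g) x x = f x x * g x x := by
  simp

lemma apply_self_eq_zero_or_one {e : IncidenceAlgebra F X} (he : e * e = e) (x : X) :
    e x x = 0 ∨ e x x = 1 := by
  have h : e x x * e x x = e x x := by rw [← mul_apply_self, he]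
  exact IsIdempotentElem.iff_eq_zero_or_one.1 h

/-- A function in the corner `e A f` vanishes as soon as it vanishes at all pairs of points at
which the diagonals of `e` and `f` do not. -/
lemma eq_zero_of_mul_eq_of_mul_eq {e f v : IncidenceAlgebra F X} (hev : e * v = v)
    (hvf : v * f = v) (h : ∀ x y, e x x ≠ 0 → f y y ≠ 0 → v x y = 0) : v = 0 := by
  suffices ∀ n : ℕ, ∀ x y, (Finset.Icc x y).card = n → v x y = 0 by
    ext x y _
    exact this _ x y rfl
  intro n
  induction n using Nat.strong_induction_on with
  | _ n ih =>
  rintro x y rfl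
  by_cases hxy : x ≤ y
  swap
  · exact apply_eq_zero_of_not_le hxy v
  have hl : v x y = e x x * v x y := by
    conv_lhs => rw [← hev, mul_apply]
    refine Finset.sum_eq_single x (fun z hz hzx => ?_) (by simp [hxy])
    rw [Finset.mem_Icc] at hz
    rw [ih _ (Finset.card_lt_card (Finset.Icc_ssubset_Icc_left hxy
      (lt_of_le_of_ne hz.1 hzx.symm) le_rfl)) z y rfl, mul_zero]
  have hr : v x y = v x y * f y y := by
    conv_lhs => rw [← hvf, mul_apply]
    refine Finset.sum_eq_single y (fun z hz hzy => ?_) (by simp [hxy])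
    rw [Finset.mem_Icc] at hz
    rw [ih _ (Finset.card_lt_card (Finset.Icc_ssubset_Icc_right hxy
      le_rfl (lt_of_le_of_ne hz.2 hzy))) x z rfl, zero_mul]
  by_cases hx : e x x = 0
  · rw [hl, hx, zero_mul]
  by_cases hy : f y y = 0
  · rw [hr, hy, mul_zero]
  exact h x y hx hy

lemma eq_zero_of_idempotent_of_apply_self {e : IncidenceAlgebra F X} (he : e * e = e)
    (h : ∀ x, e x x = 0) : e = 0 :=
  eq_zero_of_mul_eq_of_mul_eq he he fun x _ hx => (hx (h x)).elim

variable [DecidableEq X]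

/-- Evaluation at a diagonal entry, as a character of the incidence algebra. -/
def diagEval (F : Type*) {X : Type*} [Field F] [PartialOrder X] [DecidableEq X]
    [LocallyFiniteOrder X] (x : X) : IncidenceAlgebra F X →ₐ[F] F :=
  AlgHom.ofLinearMap
    { toFun := fun f => f x x
      map_add' := fun _ _ => rfl
      map_smul' := fun _ _ => rfl } (by simp) (fun f g => mul_apply_self f g x)

@[simp] lemma diagEval_apply (x : X) (f : IncidenceAlgebra F X) : diagEval F x f = f x x := rfl

/-- At a maximal point of the diagonal support of `e`, left multiplication by the diagonal unit
kills the elements of the corner `e A e` vanishing there. -/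
lemma diag_single_mul_eq_zero {e v : IncidenceAlgebra F X} {x : X}
    (hx : ∀ y, x ≤ y → e y y ≠ 0 → y = x) (hve : v * e = v) (hv : v x x = 0) :
    diag (Pi.single x 1) * v = 0 := by
  have hd : diag (Pi.single x (1 : F)) * diag (Pi.single x 1) = diag (Pi.single x 1) := by
    ext a b _
    rw [mul_apply, Finset.sum_eq_single a]
    · by_cases ha : a = x
      · subst ha; simp
      · simp [diag, ha]
    · intro z _ hz
      simp [diag, hz.symm]
    · simp_all
  refine eq_zero_of_mul_eq_of_mul_eq (e := diag (Pi.single x 1)) (f := e)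
    (by rw [← mul_assoc, hd]) (by rw [mul_assoc, hve]) fun a y ha hy => ?_
  obtain rfl : a = x := by
    by_contra hax
    exact ha (by simp [hax])
  by_cases hay : a ≤ y
  · obtain rfl := hx y hay hy
    rw [mul_apply_self, hv, mul_zero]
  · exact apply_eq_zero_of_not_le hay _

variable [Fintype X]

instance finite_module : Module.Finite F (IncidenceAlgebra F X) :=
  Module.Finite.of_injective
    ({ toFun := fun f => (f : X → X → F)
       map_add' := fun _ _ => rfl
       map_smul' := fun _ _ => rfl } : IncidenceAlgebra F X →ₗ[F] X → X → F)
    DFunLike.coe_injective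

lemma card_diagSupport_lt {e p : IncidenceAlgebra F X} (he : e * e = e) (hp : p * p = p)
    (hep : e * p = p) (hpe : p * e = p) (hne : p ≠ e) :
    (diagSupport p).card < (diagSupport e).card := by
  refine Finset.card_lt_card (Finset.ssubset_iff_subset_ne.2 ⟨fun x hx => ?_, fun heq => hne ?_⟩)
  · rw [mem_diagSupport, ← hep, mul_apply_self] at hx
    exact mem_diagSupport.2 (left_ne_zero_of_mul hx)
  · have hq : (e - p) * (e - p) = e - p := by
      simp only [mul_sub, sub_mul, he, hep, hpe, hp]; abel
    refine (sub_eq_zero.1 (eq_zero_of_idempotent_of_apply_self hq fun x => ?_)).symm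
    rw [sub_apply, sub_eq_zero]
    have hx := Finset.ext_iff.1 heq x
    simp only [mem_diagSupport] at hx
    rcases apply_self_eq_zero_or_one he x with h1 | h1 <;>
      rcases apply_self_eq_zero_or_one hp x with h2 | h2 <;> simp_all

lemma finrank_range_cornerMap_le {e f : IncidenceAlgebra F X} (he : e * e = e)
    (hf : f * f = f) : Module.finrank F (LinearMap.range (cornerMap F e f)) ≤
      (diagSupport e).card * (diagSupport f).card := by
  let φ : IncidenceAlgebra F X →ₗ[F] (diagSupport e × diagSupport f → F) :=
    { toFun := fun v p => v p.1 p.2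
      map_add' := fun _ _ => rfl
      map_smul' := fun _ _ => rfl }
  have hinj : Function.Injective (φ.domRestrict (LinearMap.range (cornerMap F e f))) := by
    rw [injective_iff_map_eq_zero]
    rintro ⟨_, v, rfl⟩ hv
    refine Subtype.ext <| eq_zero_of_mul_eq_of_mul_eq (mul_cornerMap he f v) (cornerMap_mul hf e v)
      fun x y hx hy => ?_
    exact congrFun hv (⟨x, mem_diagSupport.2 hx⟩, ⟨y, mem_diagSupport.2 hy⟩)
  simpa using LinearMap.finrank_le_finrank_of_injective hinj

lemma card_diagSupport_le_finrank {e : IncidenceAlgebra F X} (he : e * e = e) :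
    (diagSupport e).card ≤ Module.finrank F (LinearMap.range (cornerMap F e e)) := by
  let φ : IncidenceAlgebra F X →ₗ[F] (diagSupport e → F) :=
    { toFun := fun v x => v x x
      map_add' := fun _ _ => rfl
      map_smul' := fun _ _ => rfl }
  have hsurj : Function.Surjective (φ.domRestrict (LinearMap.range (cornerMap F e e))) := by
    intro c
    let d : X → F := fun x => if h : x ∈ diagSupport e then c ⟨x, h⟩ else 0
    refine ⟨⟨_, diag d, rfl⟩, funext fun x => ?_⟩
    change (e * diag d * e) x x = c x
    have hx := (apply_self_eq_zero_or_one he x).resolve_left (mem_diagSupport.1 x.2)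
    rw [mul_apply_self, mul_apply_self, hx, diag_apply_self, one_mul, mul_one]
    exact dif_pos x.2
  simpa using LinearMap.finrank_le_finrank_of_surjective hsurj

variable {G : Type*} [AddCommGroup G] [DecidableEq G]

/-- Some diagonal entry detects all nonzero homogeneous elements of the corner of a primitive
degree-zero idempotent. -/
lemma exists_apply_self_ne_zero (ℬ : G → Submodule F (IncidenceAlgebra F X)) [GradedAlgebra ℬ]
    {e : IncidenceAlgebra F X}
    (he : IsPrimitiveIdempotentIn (ℬ 0 : Set (IncidenceAlgebra F X)) e) :
    ∃ x : X, ∀ (g : G) (v : IncidenceAlgebra F X), v ∈ ℬ g → e * v = v → v * e = v →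
      v x x = 0 → v = 0 := by
  classical
  obtain ⟨x, hx⟩ : ∃ x, Maximal (· ∈ diagSupport e) x := by
    refine (diagSupport e).exists_maximal ?_
    rw [Finset.nonempty_iff_ne_empty]
    intro h
    refine he.ne_zero (eq_zero_of_idempotent_of_apply_self he.idem fun x => ?_)
    by_contra hx
    exact Finset.notMem_empty x (h ▸ mem_diagSupport.2 hx)
  have hxe := (apply_self_eq_zero_or_one he.idem x).resolve_left (mem_diagSupport.1 hx.prop)
  refine ⟨x, fun g v hv hev hve hvx => ?_⟩
  set d : IncidenceAlgebra F X := e * diag (Pi.single x 1) * e with hd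
  have hdv : d * v = 0 := by
    rw [hd, mul_assoc, hev, mul_assoc, diag_single_mul_eq_zero
      (fun y hxy hy => (hx.eq_of_le (mem_diagSupport.2 hy) hxy).symm) hve hvx, mul_zero]
  have hdx : d x x ≠ 0 := by
    rw [hd, mul_apply_self, mul_apply_self, hxe, diag_apply_self]
    simp
  obtain ⟨h, hh⟩ : ∃ h : G, (DirectSum.decompose ℬ d h : IncidenceAlgebra F X) x x ≠ 0 := by
    by_contra! hall
    refine hdx ?_
    rw [← diagEval_apply, ← DirectSum.sum_support_decompose ℬ d, map_sum]
    exact Finset.sum_eq_zero fun h _ => hall h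
  have hev' : e * d = d := by simp only [hd, ← mul_assoc, he.idem]
  have hve' : d * e = d := by simp only [hd, mul_assoc, he.idem]
  have hl : e * (DirectSum.decompose ℬ d h : IncidenceAlgebra F X) = DirectSum.decompose ℬ d h := by
    rw [← DirectSum.coe_decompose_mul_add_of_left_mem ℬ he.mem, hev', zero_add]
  have hr : (DirectSum.decompose ℬ d h : IncidenceAlgebra F X) * e = DirectSum.decompose ℬ d h := by
    rw [← DirectSum.coe_decompose_mul_add_of_right_mem ℬ he.mem, hve', add_zero]
  have hz : (DirectSum.decompose ℬ d h : IncidenceAlgebra F X) * v = 0 := by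
    rw [← DirectSum.coe_decompose_mul_add_of_right_mem ℬ hv, hdv]
    simp
  obtain ⟨y, -, -, hy⟩ := exists_corner_inverse ℬ (diagEval F x) he
    (DirectSum.decompose ℬ d h).2 hl hr hh
  rw [← hev, ← hy, mul_assoc, hz, mul_zero]

/-- The corner of a primitive degree-zero idempotent is commutative. -/
lemma corner_mul_comm (ℬ : G → Submodule F (IncidenceAlgebra F X)) [GradedAlgebra ℬ]
    {e : IncidenceAlgebra F X}
    (he : IsPrimitiveIdempotentIn (ℬ 0 : Set (IncidenceAlgebra F X)) e)
    (a b : IncidenceAlgebra F X) :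
    (e * a * e) * (e * b * e) = (e * b * e) * (e * a * e) := by
  obtain ⟨x, hx⟩ := exists_apply_self_ne_zero ℬ he
  induction a using DirectSum.Decomposition.inductionOn ℬ with
  | zero => simp
  | add a a' ha ha' => simp only [mul_add, add_mul, ha, ha']
  | @homogeneous g a =>
  induction b using DirectSum.Decomposition.inductionOn ℬ with
  | zero => simp
  | add b b' hb hb' => simp only [mul_add, add_mul, hb, hb']
  | @homogeneous h b =>
  have hmem : ∀ {k : G} (c : ℬ k), e * (c : IncidenceAlgebra F X) * e ∈ ℬ k := by
    intro k c
    simpa using SetLike.mul_mem_graded (SetLike.mul_mem_graded he.mem c.2) he.mem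
  refine sub_eq_zero.1 (hx (g + h) _ (sub_mem (SetLike.mul_mem_graded (hmem a) (hmem b))
    (add_comm h g ▸ SetLike.mul_mem_graded (hmem b) (hmem a))) ?_ ?_ ?_)
  · simp only [mul_sub, ← mul_assoc, he.idem]
  · simp only [sub_mul, mul_assoc, he.idem]
  · rw [sub_apply, mul_apply_self, mul_apply_self (e * (b : IncidenceAlgebra F X) * e), mul_comm,
      sub_self]

lemma finrank_homogeneous_corner_le_one (ℬ : G → Submodule F (IncidenceAlgebra F X))
    [GradedAlgebra ℬ] {e : IncidenceAlgebra F X}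
    (he : IsPrimitiveIdempotentIn (ℬ 0 : Set (IncidenceAlgebra F X)) e) (g : G) :
    Module.finrank F
      ↥(ℬ g ⊓ LinearMap.eqLocus (cornerMap F e e) (LinearMap.id (R := F))) ≤ 1 := by
  obtain ⟨x, hx⟩ := exists_apply_self_ne_zero ℬ he
  have hinj : Function.Injective ((diagEval F x).toLinearMap.domRestrict
      (ℬ g ⊓ LinearMap.eqLocus (cornerMap F e e) (LinearMap.id (R := F)))) := by
    rw [injective_iff_map_eq_zero]
    rintro ⟨v, hv, hve⟩ h
    have hve : cornerMap F e e v = v := hve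
    exact Subtype.ext <|
      hx g v hv (hve ▸ mul_cornerMap he.idem e v) (hve ▸ cornerMap_mul he.idem e v) h
  simpa using LinearMap.finrank_le_finrank_of_injective hinj

end IncidenceAlgebra

/-- Any grading of a finite incidence algebra by an additive abelian group admits a
complete family of orthogonal homogeneous idempotents whose corners are commutative
graded division algebras with homogeneous components of dimension at most one, and the
mixed corners have dimension bounded by the product of the dimensions of the diagonal
corners. -/
theorem exists_complete_family_of_minimal_homogeneous_idempotents
    {F X G : Type*} [Field F] [PartialOrder X] [Fintype X] [DecidableEq X]
    [LocallyFiniteOrder X] [AddCommGroup G] [DecidableEq G]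
    (ℬ : G → Submodule F (IncidenceAlgebra F X)) [GradedAlgebra ℬ] :
    ∃ (t : ℕ) (e : Fin t → IncidenceAlgebra F X),
      (∀ i, e i ∈ ℬ 0) ∧
      (∀ i, e i * e i = e i) ∧
      (∀ i j, i ≠ j → e i * e j = 0) ∧
      (∑ i, e i) = 1 ∧
      (∀ i, ∀ a b : IncidenceAlgebra F X,
        (e i * a * e i) * (e i * b * e i) = (e i * b * e i) * (e i * a * e i)) ∧
      (∀ i (g : G) (x : IncidenceAlgebra F X), x ∈ ℬ g → e i * x * e i = x → x ≠ 0 →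
        ∃ y : IncidenceAlgebra F X, e i * y * e i = y ∧ x * y = e i ∧ y * x = e i) ∧
      (∀ i (g : G), Module.finrank F
        ↥(ℬ g ⊓ LinearMap.eqLocus (cornerMap F (e i) (e i)) (LinearMap.id (R := F))) ≤ 1) ∧
      (∀ i j, Module.finrank F ↥(LinearMap.range (cornerMap F (e i) (e j))) ≤
        Module.finrank F ↥(LinearMap.range (cornerMap F (e i) (e i))) *
        Module.finrank F ↥(LinearMap.range (cornerMap F (e j) (e j)))) := by
  obtain ⟨ι, _, f, hf, horth, hsum⟩ := exists_orthogonal_primitive_decomposition (ℬ 0)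
    (fun e => (IncidenceAlgebra.diagSupport e).card)
    (fun _ _ => IncidenceAlgebra.card_diagSupport_lt) 1 SetLike.GradedOne.one_mem (mul_one 1)
  let σ := (Fintype.equivFin ι).symm
  refine ⟨Fintype.card ι, f ∘ σ, fun i => (hf _).mem, fun i => (hf _).idem,
    fun i j hij => horth _ _ (σ.injective.ne hij), ?_,
    fun i => IncidenceAlgebra.corner_mul_comm ℬ (hf _), fun i g x hx hex hx0 => ?_,
    fun i => IncidenceAlgebra.finrank_homogeneous_corner_le_one ℬ (hf _), fun i j => ?_⟩
  · rw [← hsum]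
    exact σ.sum_comp f
  · obtain ⟨z, hz⟩ := IncidenceAlgebra.exists_apply_self_ne_zero ℬ (hf (σ i))
    have hl : f (σ i) * x = x := hex ▸ mul_cornerMap (F := F) (hf (σ i)).idem _ x
    have hr : x * f (σ i) = x := hex ▸ cornerMap_mul (F := F) (hf (σ i)).idem _ x
    exact exists_corner_inverse ℬ (IncidenceAlgebra.diagEval F z) (hf _) hx hl hr
      fun h => hx0 (hz g x hx hl hr h)
  · exact (IncidenceAlgebra.finrank_range_cornerMap_le (hf _).idem (hf _).idem).trans
      (Nat.mul_le_mul (IncidenceAlgebra.card_diagSupport_le_finrank (hf _).idem)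
        (IncidenceAlgebra.card_diagSupport_le_finrank (hf _).idem))
end

section
/- Let F be a field, G an abelian (multiplicative) group, and H₁, H₂ finite subgroups of G with K = H₁ ⊓ H₂. Assume F contains a primitive root of unity of order Monoid.exponent K. Let V be a finite-dimensional F-vector space together with a family of submodules W : G → Submodule F V forming an internal direct sum (DirectSum.IsInternal W), and let ρ : H₁ →* (V ≃ₗ[F] V) and σ : H₂ →* (V ≃ₗ[F] V) be group homomorphisms such that ρ h₁ and σ h₂ commute for all h₁ ∈ H₁, h₂ ∈ H₂, ρ h₁ maps W g into W (↑h₁ * g), and σ h₂ maps W g into W (g * ↑h₂), for all g ∈ G. Then there exist s ∈ ℕ, degrees g : Fin s → G, nonzero vectors m : Fin s → V with m i ∈ W (g i), and characters χ : Fin s → (K →* Fˣ) such that: (a) for every i and every h ∈ K, ρ h (m i) = χ i h • σ h (m i) (where h is viewed in H₁ resp. H₂ via the inclusions); (b) the submodules N i := Submodule.span F {ρ h₁ (σ h₂ (m i)) | h₁ ∈ H₁, h₂ ∈ H₂} are independent and their supremum is all of V (V is their internal direct sum); (c) finrank F (N i) = Nat.card (H₁ ⊔ H₂) for every i. -/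
open Polynomial in
/-- An endomorphism whose `n`-th power is trivial is diagonalizable over a field containing a
primitive `n`-th root of unity. -/
theorem Module.End.iSup_eigenspace_eq_top_of_pow_eq_one {F V : Type*} [Field F] [AddCommGroup V]
    [Module F V] {n : ℕ} (hn : 0 < n) {ζ : F} (hζ : IsPrimitiveRoot ζ n)
    {f : Module.End F V} (hf : f ^ n = 1) : ⨆ μ, f.eigenspace μ = ⊤ := by
  classical
  have key (s : Finset F) :
      LinearMap.ker (aeval f (∏ a ∈ s, (X - C a))) ≤ ⨆ μ, f.eigenspace μ := by
    induction s using Finset.induction_on with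
    | empty => simp [Module.End.one_eq_id, LinearMap.ker_id]
    | insert a s ha ih =>
      have hcop : IsCoprime (X - C a) (∏ b ∈ s, (X - C b)) :=
        IsCoprime.prod_right fun b hb => isCoprime_X_sub_C_of_isUnit_sub
          (sub_ne_zero.2 (ne_of_mem_of_not_mem hb ha).symm).isUnit
      rw [Finset.prod_insert ha, ← sup_ker_aeval_eq_ker_aeval_mul_of_coprime f hcop]
      refine sup_le (le_trans (le_of_eq ?_) (le_iSup f.eigenspace a)) ih
      rw [Module.End.eigenspace_def]
      simp [Algebra.algebraMap_eq_smul_one]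
  have h := key (nthRootsFinset n 1)
  rw [← X_pow_sub_one_eq_prod hn hζ] at h
  refine top_le_iff.1 (le_trans (le_of_eq ?_) h)
  simp [hf]

open Polynomial in
/-- Over a field with enough roots of unity, a finite abelian group acting on a
finite-dimensional space has a basis of simultaneous eigenvectors. -/
theorem exists_basis_forall_apply_eq_character_smul {F K V : Type*} [Field F] [CommGroup K]
    [Finite K] [AddCommGroup V] [Module F V] [FiniteDimensional F V]
    (hroot : ∃ ζ : F, IsPrimitiveRoot ζ (Monoid.exponent K)) (T : K →* Module.End F V) :
    ∃ (n : ℕ) (b : Module.Basis (Fin n) F V) (χ : Fin n → (K →* Fˣ)),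
      ∀ i k, T k (b i) = ((χ i k : Fˣ) : F) • b i := by
  obtain ⟨ζ, hζ⟩ := hroot
  have hn : Monoid.exponent K ≠ 0 := Monoid.exponent_ne_zero_of_finite
  have hT (k : K) : T k ^ Monoid.exponent K = 1 := by
    rw [← map_pow, Monoid.pow_exponent_eq_one, map_one]
  have hsep : (X ^ Monoid.exponent K - 1 : F[X]).Separable := by
    have : NeZero (Monoid.exponent K) := ⟨hn⟩
    exact X_pow_sub_one_separable_iff.2 hζ.neZero'.out
  have hss (k : K) : (T k).IsFinitelySemisimple :=
    (Module.End.isSemisimple_of_squarefree_aeval_eq_zero hsep.squarefree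
      (by simp [hT])).isFinitelySemisimple
  have htop : ⨆ c : K → F, ⨅ k, (T k).eigenspace (c k) = ⊤ := by
    have := Module.End.iSup_iInf_maxGenEigenspace_eq_top_of_iSup_maxGenEigenspace_eq_top_of_commute
      (fun k => T k) (fun k l _ => (Commute.all k l).map T) (fun k => by
        simp_rw [(hss k).maxGenEigenspace_eq_eigenspace]
        exact Module.End.iSup_eigenspace_eq_top_of_pow_eq_one hn.bot_lt hζ (hT k))
    simpa only [(hss _).maxGenEigenspace_eq_eigenspace] using this
  have hspan : ⊤ ≤ Submodule.span F {v : V | ∃ c : K → F, ∀ k, T k v = c k • v} := by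
    rw [← htop]
    refine iSup_le fun c v hv => Submodule.subset_span ⟨c, fun k => ?_⟩
    exact Module.End.mem_eigenspace_iff.1 ((Submodule.mem_iInf _).1 hv k)
  let b₀ := Module.Basis.ofSpan hspan
  have hfin := FiniteDimensional.fintypeBasisIndex b₀
  let b := b₀.reindex (Fintype.equivFin _)
  have hb (i) : ∃ c : K → F, ∀ k, T k (b i) = c k • b i := by
    have : b i ∈ Set.range b₀ := by simp [b]
    exact Module.Basis.ofSpan_subset hspan this
  choose c hc using hb
  have hone (i) : c i 1 = 1 := by
    have h := hc i 1
    rw [map_one, Module.End.one_apply] at h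
    exact (smul_left_injective F (b.ne_zero i) (by simpa using h)).symm
  have hmul (i k l) : c i (k * l) = c i k * c i l := by
    refine smul_left_injective F (b.ne_zero i) ?_
    simp only
    rw [← hc, map_mul, Module.End.mul_apply, hc, map_smul, hc, smul_smul, mul_comm]
  exact ⟨_, b, fun i => MonoidHom.toHomUnits ⟨⟨c i, hone i⟩, hmul i⟩, fun i k => hc i k⟩

/-- Grouping the vectors of a basis along a map of the index type gives an internal direct sum
decomposition. -/
theorem Module.Basis.isInternal_span_fibers {F V κ ι : Type*} [Field F] [AddCommGroup V]
    [Module F V] [DecidableEq ι] (b : Module.Basis κ F V) (π : κ → ι) :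
    DirectSum.IsInternal fun i => Submodule.span F (b '' (π ⁻¹' {i})) := by
  rw [DirectSum.isInternal_submodule_iff_iSupIndep_and_iSup_eq_top]
  refine ⟨fun i => ?_, ?_⟩
  · simp_rw [← Submodule.span_iUnion, ← Set.image_iUnion]
    refine b.linearIndependent.disjoint_span_image ?_
    rw [Set.disjoint_left]
    intro x hx hx'
    simp only [Set.mem_iUnion] at hx'
    obtain ⟨j, hj, hx'⟩ := hx'
    exact hj (hx'.symm.trans hx)
  · rw [← Submodule.span_iUnion, ← Set.image_iUnion, ← Set.preimage_iUnion, Set.iUnion_of_singleton,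
      Set.preimage_univ, Set.image_univ, b.span_eq]

theorem Module.Basis.finrank_span_image {F V κ : Type*} [Field F] [AddCommGroup V]
    [Module F V] (b : Module.Basis κ F V) (s : Set κ) :
    Module.finrank F (Submodule.span F (b '' s)) = Nat.card s := by
  have h := b.linearIndependent.comp ((↑) : s → κ) Subtype.val_injective
  rw [← Module.finrank_eq_nat_card_basis (Module.Basis.span h), Set.range_comp,
    Subtype.range_coe]

/-- Structure of `G`-graded bimodules over group algebras of finite subgroups `H₁, H₂`
of an abelian group `G` (stated via commuting graded actions of `H₁` and `H₂` on a
graded vector space): the space splits into an internal direct sum of sub-bimodules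
generated by homogeneous vectors `m i`, on which `H₁ ⊓ H₂` acts on both sides through a
character, and each summand has dimension `|H₁ ⊔ H₂|`. -/
theorem graded_bimodule_structure
    {F G V : Type*} [Field F] [CommGroup G] [DecidableEq G]
    [AddCommGroup V] [Module F V] [FiniteDimensional F V]
    (H₁ H₂ : Subgroup G) [Finite ↥H₁] [Finite ↥H₂]
    (hroot : ∃ ζ : F, IsPrimitiveRoot ζ (Monoid.exponent ↥(H₁ ⊓ H₂)))
    (W : G → Submodule F V) (hW : DirectSum.IsInternal W)
    (ρ : ↥H₁ →* (V ≃ₗ[F] V)) (σ : ↥H₂ →* (V ≃ₗ[F] V))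
    (hcomm : ∀ (h₁ : ↥H₁) (h₂ : ↥H₂) (v : V), ρ h₁ (σ h₂ v) = σ h₂ (ρ h₁ v))
    (hρ : ∀ (h₁ : ↥H₁) (g : G) (v : V), v ∈ W g → ρ h₁ v ∈ W ((h₁ : G) * g))
    (hσ : ∀ (h₂ : ↥H₂) (g : G) (v : V), v ∈ W g → σ h₂ v ∈ W (g * (h₂ : G))) :
    ∃ (s : ℕ) (g : Fin s → G) (m : Fin s → V) (χ : Fin s → (↥(H₁ ⊓ H₂) →* Fˣ)),
      (∀ i, m i ≠ 0) ∧
      (∀ i, m i ∈ W (g i)) ∧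
      (∀ (i : Fin s) (h : ↥(H₁ ⊓ H₂)),
        ρ (Subgroup.inclusion inf_le_left h) (m i) =
          ((χ i h : Fˣ) : F) • σ (Subgroup.inclusion inf_le_right h) (m i)) ∧
      DirectSum.IsInternal (fun i : Fin s =>
        Submodule.span F {v : V | ∃ (h₁ : ↥H₁) (h₂ : ↥H₂), v = ρ h₁ (σ h₂ (m i))}) ∧
      (∀ i : Fin s, Module.finrank F
        ↥(Submodule.span F {v : V | ∃ (h₁ : ↥H₁) (h₂ : ↥H₂), v = ρ h₁ (σ h₂ (m i))}) =
        Nat.card ↥(H₁ ⊔ H₂)) := by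
  classical
  let L := H₁ ⊔ H₂
  let rep : G ⧸ L → G := Quotient.out
  have hrep (q : G ⧸ L) : (QuotientGroup.mk (rep q) : G ⧸ L) = q := Quotient.out_eq q
  have hdec (g : G) : ∃ (x : H₁) (y : H₂), (x : G) * (rep (g : G ⧸ L) * y) = g := by
    have h : (rep (g : G ⧸ L))⁻¹ * g ∈ L := QuotientGroup.eq.1 (hrep g)
    obtain ⟨x, hx, y, hy, hxy⟩ := Subgroup.mem_sup.1 h
    refine ⟨⟨x, hx⟩, ⟨y, hy⟩, ?_⟩
    simp only
    rw [mul_left_comm, hxy, mul_inv_cancel_left]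
  choose x y hxy using hdec
  have hρmul (h h' : H₁) (v : V) : ρ (h * h') v = ρ h (ρ h' v) := by
    rw [map_mul, LinearEquiv.mul_apply]
  have hσmul (h h' : H₂) (v : V) : σ (h * h') v = σ h (σ h' v) := by
    rw [map_mul, LinearEquiv.mul_apply]
  have hρcancel (h : H₁) (v : V) : ρ h (ρ h⁻¹ v) = v := by
    rw [← hρmul, mul_inv_cancel, map_one, LinearEquiv.coe_one, id]
  have hσcancel (h : H₂) (v : V) : σ h (σ h⁻¹ v) = v := by
    rw [← hσmul, mul_inv_cancel, map_one, LinearEquiv.coe_one, id]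
  -- the weight-preserving action of `H₁ ⊓ H₂`
  let i₁ : ↥(H₁ ⊓ H₂) →* H₁ := Subgroup.inclusion inf_le_left
  let i₂ : ↥(H₁ ⊓ H₂) →* H₂ := Subgroup.inclusion inf_le_right
  have hT (k : ↥(H₁ ⊓ H₂)) (g : G) (v : V) (hv : v ∈ W g) : ρ (i₁ k) (σ (i₂ k)⁻¹ v) ∈ W g := by
    have h := hρ (i₁ k) _ _ (hσ (i₂ k)⁻¹ g v hv)
    have e : ((i₁ k : H₁) : G) * (g * (((i₂ k)⁻¹ : H₂) : G)) = g :=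
      mul_inv_cancel_comm_assoc (k : G) g
    rwa [e] at h
  let T (g : G) : ↥(H₁ ⊓ H₂) →* Module.End F (W g) :=
    { toFun := fun k => ((ρ (i₁ k)).toLinearMap ∘ₗ (σ (i₂ k)⁻¹).toLinearMap).restrict (hT k g)
      map_one' := by
        ext v
        simp
      map_mul' := fun k l => by
        ext v
        change ρ (i₁ (k * l)) (σ (i₂ (k * l))⁻¹ v) =
          ρ (i₁ k) (σ (i₂ k)⁻¹ (ρ (i₁ l) (σ (i₂ l)⁻¹ v)))
        rw [map_mul i₁, map_mul i₂, mul_inv, hρmul, hσmul, hcomm (i₁ l)] }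
  have hKfin : Finite ↥(H₁ ⊓ H₂) :=
    Finite.of_injective _ (Subgroup.inclusion_injective inf_le_left)
  choose n c χ hχ using fun q : G ⧸ L =>
    exists_basis_forall_apply_eq_character_smul hroot (T (rep q))
  have heigen (q : G ⧸ L) (j : Fin (n q)) (k : ↥(H₁ ⊓ H₂)) :
      ρ (i₁ k) (c q j : V) = ((χ q j k : Fˣ) : F) • σ (i₂ k) (c q j : V) := by
    have h : ρ (i₁ k) (σ (i₂ k)⁻¹ (c q j : V)) = ((χ q j k : Fˣ) : F) • (c q j : V) :=
      congrArg Subtype.val (hχ q j k)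
    rw [← map_smul, ← h, ← hcomm, hσcancel]
  -- translating the bases at the coset representatives to all degrees
  have hmap (g : G) : (W (rep g)).map ((σ (y g)).trans (ρ (x g)) : V →ₗ[F] V) = W g := by
    apply le_antisymm
    · rintro - ⟨v, hv, rfl⟩
      have h := hρ (x g) _ _ (hσ (y g) _ v hv)
      rwa [hxy] at h
    · intro v hv
      refine ⟨σ (y g)⁻¹ (ρ (x g)⁻¹ v), ?_, ?_⟩
      · have h := hσ (y g)⁻¹ _ _ (hρ (x g)⁻¹ g v hv)
        have e : (((x g)⁻¹ : H₁) : G) * g * (((y g)⁻¹ : H₂) : G) = rep g := by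
          rw [Subgroup.coe_inv, Subgroup.coe_inv, mul_inv_eq_iff_eq_mul, inv_mul_eq_iff_eq_mul,
            hxy]
        rwa [e] at h
      · change ρ (x g) (σ (y g) (σ (y g)⁻¹ (ρ (x g)⁻¹ v))) = v
        rw [hσcancel, hρcancel]
  let B : Module.Basis (Σ g : G, Fin (n (g : G ⧸ L))) F V := hW.collectedBasis fun g =>
    (c (g : G ⧸ L)).map (((σ (y g)).trans (ρ (x g))).ofSubmodules _ _ (hmap g))
  have hB (g : G) (j : Fin (n (g : G ⧸ L))) : B ⟨g, j⟩ = ρ (x g) (σ (y g) (c g j : V)) := by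
    simp only [B, DirectSum.IsInternal.collectedBasis_coe]
    rfl
  let π : (Σ g : G, Fin (n (g : G ⧸ L))) → Σ q : G ⧸ L, Fin (n q) := fun a => ⟨a.1, a.2⟩
  have hπ : Function.Surjective π := by
    rintro ⟨q, j⟩
    obtain ⟨g, rfl⟩ := QuotientGroup.mk_surjective q
    exact ⟨⟨g, j⟩, rfl⟩
  have hfinite : Finite (Σ g : G, Fin (n (g : G ⧸ L))) := Module.Finite.finite_basis B
  have hfinite' : Finite (Σ q : G ⧸ L, Fin (n q)) := Finite.of_surjective π hπ
  have hspan (q : G ⧸ L) (j : Fin (n q)) :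
      Submodule.span F {v : V | ∃ (h₁ : ↥H₁) (h₂ : ↥H₂), v = ρ h₁ (σ h₂ (c q j : V))} =
        Submodule.span F (B '' (π ⁻¹' {⟨q, j⟩})) := by
    apply le_antisymm
    · rw [Submodule.span_le]
      rintro - ⟨h₁, h₂, rfl⟩
      obtain ⟨g, hg⟩ : ∃ g : G, g = (h₁ : G) * (rep q * h₂) := ⟨_, rfl⟩
      have hgq : (g : G ⧸ L) = q := by
        rw [← hrep q, eq_comm, QuotientGroup.eq, hg, mul_left_comm, inv_mul_cancel_left]
        exact L.mul_mem (Subgroup.mem_sup_left h₁.2) (Subgroup.mem_sup_right h₂.2)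
      subst hgq
      have hxg : (h₁ : G) * h₂ = x g * y g := by
        have h := (hxy g).trans hg
        rw [mul_left_comm, mul_left_comm (h₁ : G)] at h
        exact (mul_left_cancel h).symm
      have hk : (h₁ : G) * (x g : G)⁻¹ = (y g : G) * (h₂ : G)⁻¹ := by
        rw [mul_inv_eq_iff_eq_mul, mul_right_comm, eq_mul_inv_iff_mul_eq, hxg, mul_comm]
      let k : ↥(H₁ ⊓ H₂) := ⟨(h₁ : G) * (x g : G)⁻¹, H₁.mul_mem h₁.2 (H₁.inv_mem (x g).2), by
        rw [hk]; exact H₂.mul_mem (y g).2 (H₂.inv_mem h₂.2)⟩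
      have e₁ : h₁ = x g * i₁ k := Subtype.ext (by
        change (h₁ : G) = x g * (h₁ * (x g : G)⁻¹)
        rw [mul_comm (h₁ : G), mul_inv_cancel_left])
      have e₂ : y g = h₂ * i₂ k := Subtype.ext (by
        change (y g : G) = h₂ * (h₁ * (x g : G)⁻¹)
        rw [hk, mul_comm (y g : G), mul_inv_cancel_left])
      have h : ρ h₁ (σ h₂ (c g j : V)) = ((χ g j k : Fˣ) : F) • B ⟨g, j⟩ := by
        rw [hB, e₂, hσmul, ← map_smul, ← map_smul, ← heigen, ← hcomm, ← hρmul, ← e₁]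
      rw [h]
      exact Submodule.smul_mem _ _ (Submodule.subset_span ⟨⟨g, j⟩, rfl, rfl⟩)
    · refine Submodule.span_mono ?_
      rintro - ⟨⟨g, j'⟩, h, rfl⟩
      obtain ⟨rfl, h⟩ := Sigma.mk.inj_iff.1
        (show (⟨(g : G ⧸ L), j'⟩ : Σ q, Fin (n q)) = ⟨q, j⟩ from h)
      obtain rfl := eq_of_heq h
      exact ⟨_, _, hB g j'⟩
  have hcard (q : G ⧸ L) (j : Fin (n q)) : Nat.card (π ⁻¹' {⟨q, j⟩}) = Nat.card L := by
    have hbij : Function.Bijective fun a : π ⁻¹' {(⟨q, j⟩ : Σ q : G ⧸ L, Fin (n q))} =>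
        (⟨a.1.1, congrArg Sigma.fst a.2⟩ : ((↑) : G → G ⧸ L) ⁻¹' {q}) := by
      refine ⟨?_, ?_⟩
      · rintro ⟨⟨g, a⟩, ha⟩ ⟨⟨g', a'⟩, ha'⟩ h
        obtain rfl : g = g' := congrArg Subtype.val h
        have := (Sigma.mk.inj_iff.1 ((show π ⟨g, a⟩ = ⟨q, j⟩ from ha).trans
          (show π ⟨g, a'⟩ = ⟨q, j⟩ from ha').symm)).2
        obtain rfl := eq_of_heq this
        rfl
      · rintro ⟨g, rfl⟩
        exact ⟨⟨⟨g, j⟩, rfl⟩, rfl⟩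
    rw [Nat.card_congr (Equiv.ofBijective _ hbij), QuotientGroup.card_preimage_mk]
    simp
  let e := (Finite.equivFin (Σ q : G ⧸ L, Fin (n q))).symm
  refine ⟨_, fun i => rep (e i).1, fun i => c (e i).1 (e i).2, fun i => χ (e i).1 (e i).2,
    fun i => ?_, fun i => (c (e i).1 (e i).2).2, fun i k => heigen _ _ k, ?_, fun i => ?_⟩
  · exact fun h => (c (e i).1).ne_zero (e i).2 (Subtype.ext h)
  · convert B.isInternal_span_fibers (e.symm ∘ π) using 2 with i
    rw [hspan]
    congr 2
    ext a
    simp [Equiv.symm_apply_eq]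
  · rw [hspan, B.finrank_span_image, hcard]
end
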